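/- arXiv:1908.10704 — 2 statements merged into one kernel-verified Lean document; each statement's English description precedes it below -/
import Mathlib

section
/- Let n be a positive integer and let H be a 2n×2n complex matrix which is Hermitian (H* = H) and symplectic (ᵀH J_{2n} H = J_{2n}). Then there exist natural numbers p, q with p + q = n and a matrix S ∈ Sp(2n,ℂ) such that S*·H·S = K_{p,q}. -/
open Matrix

noncomputable section

/-- The standard symplectic matrix `J_{2n} = [[0, Iₙ],[−Iₙ, 0]]`. -/
def Jmat (n : ℕ) : Matrix (Fin n ⊕ Fin n) (Fin n ⊕ Fin n) ℂ :=
  Matrix.fromBlocks 0 1 (-1) 0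

/-- `M ∈ Sp(2n,ℂ)`, i.e. `ᵀM J_{2n} M = J_{2n}`. -/
def IsSymplectic {n : ℕ} (M : Matrix (Fin n ⊕ Fin n) (Fin n ⊕ Fin n) ℂ) : Prop :=
  Mᵀ * Jmat n * M = Jmat n

/-- The matrix `I_{p,q} = diag(I_p, −I_q)` (of size `n`, with `p + q = n`). -/
def Ipq (n p : ℕ) : Matrix (Fin n) (Fin n) ℂ :=
  Matrix.diagonal (fun i => if (i : ℕ) < p then 1 else -1)

/-- The matrix `K_{p,q} = diag(I_{p,q}, I_{p,q})` of size `2n`. -/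
def Kpq (n p : ℕ) : Matrix (Fin n ⊕ Fin n) (Fin n ⊕ Fin n) ℂ :=
  Matrix.fromBlocks (Ipq n p) 0 0 (Ipq n p)

section HermitianForm

variable {m : Type*} [Fintype m]

/-- The sesquilinear form `(x, y) ↦ x* H y`. -/
def sesqForm (H : Matrix m m ℂ) (x y : m → ℂ) : ℂ := star x ⬝ᵥ (H *ᵥ y)

lemma sesqForm_add_left (H : Matrix m m ℂ) (x y z : m → ℂ) :
    sesqForm H (x + y) z = sesqForm H x z + sesqForm H y z := by
  simp [sesqForm]

lemma sesqForm_add_right (H : Matrix m m ℂ) (x y z : m → ℂ) :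
    sesqForm H x (y + z) = sesqForm H x y + sesqForm H x z := by
  simp [sesqForm, mulVec_add]

lemma sesqForm_sub_right (H : Matrix m m ℂ) (x y z : m → ℂ) :
    sesqForm H x (y - z) = sesqForm H x y - sesqForm H x z := by
  simp [sesqForm, mulVec_sub]

lemma sesqForm_smul_left (H : Matrix m m ℂ) (c : ℂ) (x y : m → ℂ) :
    sesqForm H (c • x) y = star c * sesqForm H x y := by
  simp [sesqForm]

lemma sesqForm_smul_right (H : Matrix m m ℂ) (c : ℂ) (x y : m → ℂ) :
    sesqForm H x (c • y) = c * sesqForm H x y := by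
  simp [sesqForm, mulVec_smul]

lemma sesqForm_sum_right {ι : Type*} (H : Matrix m m ℂ) (s : Finset ι) (x : m → ℂ)
    (y : ι → m → ℂ) : sesqForm H x (∑ i ∈ s, y i) = ∑ i ∈ s, sesqForm H x (y i) := by
  simp [sesqForm, mulVec_sum, dotProduct_sum]

lemma star_sesqForm {H : Matrix m m ℂ} (hH : H.IsHermitian) (x y : m → ℂ) :
    star (sesqForm H x y) = sesqForm H y x := by
  rw [sesqForm, sesqForm, ← star_dotProduct, star_mulVec, hH.eq, ← dotProduct_mulVec]

/-- Polarization: a sesquilinear form which is nonzero on a subspace has a non-isotropic vector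
there. -/
lemma exists_sesqForm_self_ne_zero {H : Matrix m m ℂ}
    (W : Submodule ℂ (m → ℂ)) {x y : m → ℂ} (hx : x ∈ W) (hy : y ∈ W)
    (hxy : sesqForm H x y ≠ 0) : ∃ w ∈ W, sesqForm H w w ≠ 0 := by
  by_contra! h
  have h1 := h _ (W.add_mem hx hy)
  have h2 := h _ (W.add_mem hx (W.smul_mem Complex.I hy))
  simp only [sesqForm_add_left, sesqForm_add_right, sesqForm_smul_left, sesqForm_smul_right,
    h x hx, h y hy] at h1 h2
  simp only [Complex.star_def, Complex.conj_I] at h2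
  apply hxy
  linear_combination (1 / 2) * h1 - (Complex.I / 2) * h2 +
    (sesqForm H x y - sesqForm H y x) / 2 * Complex.I_mul_I

open scoped ComplexOrder in
/-- An orthogonal family of vectors of square `±1` which is too short to be a basis admits a
non-isotropic vector in its orthogonal complement. -/
lemma exists_orthogonal_sesqForm_self_ne_zero {ι : Type*} [Fintype ι] [DecidableEq ι]
    [DecidableEq m] {H : Matrix m m ℂ} (hH : H.IsHermitian) (hdet : IsUnit H)
    (u : ι → m → ℂ) (η : ι → ℂ) (hη : ∀ a, η a * η a = 1)
    (hu : ∀ a b, sesqForm H (u a) (u b) = if a = b then η a else 0)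
    (hcard : Fintype.card ι < Fintype.card m) :
    ∃ w, (∀ a, sesqForm H (u a) w = 0) ∧ sesqForm H w w ≠ 0 := by
  let φ : (m → ℂ) →ₗ[ℂ] (ι → ℂ) :=
    { toFun := fun x a => sesqForm H (u a) x
      map_add' := fun x y => funext fun a => sesqForm_add_right H _ x y
      map_smul' := fun c x => funext fun a => sesqForm_smul_right H c _ x }
  have hmem : ∀ {x}, x ∈ LinearMap.ker φ ↔ ∀ a, sesqForm H (u a) x = 0 := fun {x} => by
    rw [LinearMap.mem_ker, funext_iff]; rfl
  obtain ⟨w, hw, hw0⟩ := (Submodule.ne_bot_iff _).1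
    (LinearMap.ker_ne_bot_of_finrank_lt (f := φ) (by simpa using hcard))
  obtain ⟨y, hy⟩ : ∃ y, sesqForm H w y ≠ 0 := by
    by_contra! h
    apply hw0
    have : H *ᵥ w = 0 := by
      rw [← dotProduct_star_self_eq_zero]
      exact (star_sesqForm hH w (H *ᵥ w)).symm.trans (by rw [h, star_zero])
    exact (mulVec_injective_of_isUnit hdet) (by simpa using this)
  let y' := y - ∑ a, (η a * sesqForm H (u a) y) • u a
  have hy' : y' ∈ LinearMap.ker φ := hmem.2 fun b => by
    simp only [y', sesqForm_sub_right, sesqForm_sum_right, sesqForm_smul_right, hu]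
    simp only [mul_ite, mul_zero, Finset.sum_ite_eq, Finset.mem_univ, if_true]
    linear_combination -sesqForm H (u b) y * hη b
  have hwy' : sesqForm H w y' ≠ 0 := by
    have h0 : ∀ a, sesqForm H w (u a) = 0 := fun a => by
      rw [← star_sesqForm hH, hmem.1 hw a, star_zero]
    simpa [y', sesqForm_sub_right, sesqForm_sum_right, sesqForm_smul_right, h0] using hy
  obtain ⟨z, hz, hz0⟩ := exists_sesqForm_self_ne_zero _ hw hy' hwy'
  exact ⟨z, hmem.1 hz, hz0⟩

/-- A non-isotropic vector of a Hermitian form can be rescaled to have square `±1`. -/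
lemma exists_smul_sesqForm_self {H : Matrix m m ℂ} (hH : H.IsHermitian) {w : m → ℂ}
    (hw : sesqForm H w w ≠ 0) :
    ∃ c : ℂ, sesqForm H (c • w) (c • w) = 1 ∨ sesqForm H (c • w) (c • w) = -1 := by
  obtain ⟨r, hr⟩ := Complex.conj_eq_iff_real.1 (star_sesqForm hH w w)
  have hr0 : r ≠ 0 := by rintro rfl; exact hw (by simpa using hr)
  have hs : (√|r|)⁻¹ * ((√|r|)⁻¹ * r) = r / |r| := by
    rw [← mul_assoc, ← mul_inv, Real.mul_self_sqrt (abs_nonneg r), div_eq_inv_mul]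
  refine ⟨((√|r|)⁻¹ : ℝ), ?_⟩
  rw [sesqForm_smul_left, sesqForm_smul_right, hr, Complex.star_def, Complex.conj_ofReal]
  norm_cast
  rw [hs]
  rcases lt_or_gt_of_ne hr0 with h | h
  · right; rw [abs_of_neg h]; push_cast; field_simp
  · left; rw [abs_of_pos h]; field_simp

end HermitianForm

section Quaternionic

variable {n : ℕ}

lemma Jmat_mul_self (n : ℕ) : Jmat n * Jmat n = -1 := by
  simp [Jmat, fromBlocks_multiply, ← fromBlocks_one, fromBlocks_neg]

lemma Jmat_transpose (n : ℕ) : (Jmat n)ᵀ = -Jmat n := by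
  simp [Jmat, fromBlocks_transpose, fromBlocks_neg]

lemma Jmat_conjTranspose (n : ℕ) : (Jmat n)ᴴ = -Jmat n := by
  simp [Jmat, fromBlocks_conjTranspose, fromBlocks_neg]

/-- The symplectic form `(x, y) ↦ ᵀx J y`. -/
def sympForm (x y : Fin n ⊕ Fin n → ℂ) : ℂ := x ⬝ᵥ (Jmat n *ᵥ y)

lemma sympForm_swap (x y : Fin n ⊕ Fin n → ℂ) : sympForm x y = -sympForm y x := by
  rw [sympForm, sympForm, dotProduct_mulVec, dotProduct_comm, ← mulVec_transpose,
    Jmat_transpose, neg_mulVec, dotProduct_neg]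

lemma sympForm_self (x : Fin n ⊕ Fin n → ℂ) : sympForm x x = 0 :=
  self_eq_neg.1 (sympForm_swap x x)

/-- The antilinear map `σ` with `ω (σ x) y = h x y`, where `ω` is the symplectic form and `h`
the Hermitian form of `H`. -/
def quatConj (H : Matrix (Fin n ⊕ Fin n) (Fin n ⊕ Fin n) ℂ) (x : Fin n ⊕ Fin n → ℂ) :
    Fin n ⊕ Fin n → ℂ := Jmat n *ᵥ star (H *ᵥ x)

variable {H : Matrix (Fin n ⊕ Fin n) (Fin n ⊕ Fin n) ℂ}

lemma sympForm_quatConj_left (hH : H.IsHermitian) (x y : Fin n ⊕ Fin n → ℂ) :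
    sympForm (quatConj H x) y = sesqForm H x y := by
  rw [sympForm, quatConj, dotProduct_mulVec, ← mulVec_transpose, mulVec_mulVec, Jmat_transpose,
    neg_mul, Jmat_mul_self, neg_neg, one_mulVec, star_mulVec, hH.eq, sesqForm,
    dotProduct_mulVec]

lemma quatConj_quatConj (hH : H.IsHermitian) (hsp : IsSymplectic H)
    (x : Fin n ⊕ Fin n → ℂ) : quatConj H (quatConj H x) = -x := by
  have hJ : star (Jmat n *ᵥ star (H *ᵥ x)) = Jmat n *ᵥ (H *ᵥ x) := by
    rw [star_mulVec, star_star, Jmat_conjTranspose, ← Jmat_transpose, vecMul_transpose]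
  have hstar : ∀ z, star (H *ᵥ z) = Hᵀ *ᵥ star z := fun z => by
    rw [star_mulVec, hH.eq, mulVec_transpose]
  rw [quatConj, quatConj, hstar, hJ, mulVec_mulVec, mulVec_mulVec, mulVec_mulVec,
    Matrix.mul_assoc (Jmat n), Matrix.mul_assoc (Jmat n), hsp, Jmat_mul_self, neg_mulVec,
    one_mulVec]

lemma sympForm_eq_sesqForm (hH : H.IsHermitian) (hsp : IsSymplectic H)
    (x y : Fin n ⊕ Fin n → ℂ) : sympForm x y = -sesqForm H (quatConj H x) y := by
  rw [← sympForm_quatConj_left hH, quatConj_quatConj hH hsp, sympForm, sympForm, neg_dotProduct,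
    neg_neg]

lemma sesqForm_quatConj_quatConj (hH : H.IsHermitian) (hsp : IsSymplectic H)
    (x y : Fin n ⊕ Fin n → ℂ) : sesqForm H (quatConj H x) (quatConj H y) = sesqForm H y x := by
  rw [← neg_eq_iff_eq_neg.2 (sympForm_eq_sesqForm hH hsp x (quatConj H y)), sympForm_swap,
    neg_neg, sympForm_quatConj_left hH]

lemma sesqForm_quatConj_swap (hH : H.IsHermitian) (x y : Fin n ⊕ Fin n → ℂ) :
    sesqForm H x (quatConj H y) = -sesqForm H y (quatConj H x) := by
  rw [← sympForm_quatConj_left hH, sympForm_swap, sympForm_quatConj_left hH]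

lemma sesqForm_quatConj_self (hH : H.IsHermitian) (x : Fin n ⊕ Fin n → ℂ) :
    sesqForm H x (quatConj H x) = 0 := by
  rw [← sympForm_quatConj_left hH, sympForm_self]

lemma IsSymplectic.isUnit (hsp : IsSymplectic H) : IsUnit H := by
  have h : (-(Jmat n * Hᵀ * Jmat n)) * H = 1 := by
    rw [neg_mul, Matrix.mul_assoc, Matrix.mul_assoc, ← Matrix.mul_assoc Hᵀ, hsp, Jmat_mul_self,
      neg_neg]
  exact IsUnit.of_mul_eq_one_right _ h

/-- A quaternionic orthonormal family for the form of `H`, with signs `ε`. -/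
def IsQuatOrthonormal (H : Matrix (Fin n ⊕ Fin n) (Fin n ⊕ Fin n) ℂ) {ι : Type*} [DecidableEq ι]
    (v : ι → Fin n ⊕ Fin n → ℂ) (ε : ι → ℂ) : Prop :=
  (∀ i, ε i = 1 ∨ ε i = -1) ∧ (∀ i j, sesqForm H (v i) (v j) = if i = j then ε i else 0) ∧
    ∀ i j, sesqForm H (v i) (quatConj H (v j)) = 0

lemma exists_isQuatOrthonormal (hH : H.IsHermitian) (hsp : IsSymplectic H) (k : ℕ) (hk : k ≤ n) :
    ∃ (v : Fin k → Fin n ⊕ Fin n → ℂ) (ε : Fin k → ℂ), IsQuatOrthonormal H v ε := by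
  induction k with
  | zero => exact ⟨fun i => i.elim0, fun i => i.elim0, fun i => i.elim0, fun i => i.elim0,
      fun i => i.elim0⟩
  | succ k ih =>
    obtain ⟨v, ε, hε, hv, hvσ⟩ := ih (by omega)
    obtain ⟨w, hw, hw0⟩ := exists_orthogonal_sesqForm_self_ne_zero hH hsp.isUnit
      (Sum.elim v fun i => quatConj H (v i)) (Sum.elim ε ε)
      (by rintro (i | i) <;> rcases hε i with h | h <;> simp [h])
      (by
        rintro (i | i) (j | j)
        · simp [hv]
        · simp [hvσ]
        · simp [← star_sesqForm hH (v j), hvσ]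
        · by_cases h : i = j
          · simp [sesqForm_quatConj_quatConj hH hsp, hv, h]
          · simp [sesqForm_quatConj_quatConj hH hsp, hv, h, Ne.symm h])
      (by simp; omega)
    obtain ⟨c, hc⟩ := exists_smul_sesqForm_self hH hw0
    set z := c • w with hz
    have hvz : ∀ i, sesqForm H (v i) z = 0 := fun i => by
      simpa [hz, sesqForm_smul_right] using Or.inr (hw (Sum.inl i))
    have hzσ : ∀ i, sesqForm H z (quatConj H (v i)) = 0 := fun i => by
      rw [← star_sesqForm hH, hz, sesqForm_smul_right]
      simpa using Or.inr (hw (Sum.inr i))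
    refine ⟨Fin.cons z v, Fin.cons (sesqForm H z z) ε, ?_, ?_, ?_⟩
    · exact Fin.cases (by simpa using hc) (by simpa using hε)
    · refine Fin.cases (Fin.cases (by simp) fun j => ?_) fun i => Fin.cases ?_ fun j => ?_
      · simp [← star_sesqForm hH (v j), hvz, (Fin.succ_ne_zero j).symm]
      · simp [hvz]
      · simp [hv]
    · refine Fin.cases (Fin.cases ?_ fun j => ?_) fun i => Fin.cases ?_ fun j => ?_
      · simpa using sesqForm_quatConj_self hH z
      · simpa using hzσ j
      · simpa [hzσ] using sesqForm_quatConj_swap hH (v i) z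
      · simpa using hvσ i j

lemma IsQuatOrthonormal.comp_equiv {ι κ : Type*} [DecidableEq ι] [DecidableEq κ]
    {v : ι → Fin n ⊕ Fin n → ℂ} {ε : ι → ℂ} (h : IsQuatOrthonormal H v ε) (e : κ ≃ ι) :
    IsQuatOrthonormal H (v ∘ e) (ε ∘ e) :=
  ⟨fun i => h.1 _, fun i j => by simp [h.2.1], fun i j => h.2.2 _ _⟩

/-- The matrix with columns `v i` and `-ε i • σ (v i)`. -/
def quatBasisMatrix (H : Matrix (Fin n ⊕ Fin n) (Fin n ⊕ Fin n) ℂ)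
    (v : Fin n → Fin n ⊕ Fin n → ℂ) (ε : Fin n → ℂ) :
    Matrix (Fin n ⊕ Fin n) (Fin n ⊕ Fin n) ℂ :=
  (Matrix.of (Sum.elim v fun i => (-ε i) • quatConj H (v i)))ᵀ

lemma transpose_mul_mul_apply {m k : Type*} [Fintype m] (A : Matrix m m ℂ) (u : k → m → ℂ)
    (a b : k) : (of u * A * (of u)ᵀ) a b = u a ⬝ᵥ (A *ᵥ u b) := by
  rw [mul_apply', dotProduct_mulVec]
  rfl

lemma conjTranspose_mul_mul_apply {m k : Type*} [Fintype m] (A : Matrix m m ℂ) (u : k → m → ℂ)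
    (a b : k) : ((of u)ᵀᴴ * A * (of u)ᵀ) a b = sesqForm A (u a) (u b) := by
  rw [mul_apply', sesqForm, dotProduct_mulVec]
  rfl

lemma IsQuatOrthonormal.isSymplectic (hH : H.IsHermitian) (hsp : IsSymplectic H)
    {v : Fin n → Fin n ⊕ Fin n → ℂ} {ε : Fin n → ℂ} (h : IsQuatOrthonormal H v ε) :
    IsSymplectic (quatBasisMatrix H v ε) := by
  obtain ⟨hε, hv, hvσ⟩ := h
  have hε2 : ∀ i, ε i * ε i = 1 := fun i => by rcases hε i with h | h <;> simp [h]
  have hσv : ∀ i j, sesqForm H (quatConj H (v i)) (v j) = 0 := fun i j => by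
    rw [← star_sesqForm hH, hvσ, star_zero]
  have hsmul : ∀ (c : ℂ) x y, sympForm (n := n) x (c • y) = c * sympForm x y := fun c x y => by
    simp [sympForm, mulVec_smul]
  have hinl : ∀ i j, sympForm (v i) ((-ε j) • quatConj H (v j)) = if i = j then 1 else 0 :=
    fun i j => by
      rw [hsmul, sympForm_swap, sympForm_quatConj_left hH, hv]
      by_cases hij : i = j
      · simp [hij, hε2]
      · simp [hij, Ne.symm hij]
  ext a b
  rw [quatBasisMatrix, transpose_transpose, transpose_mul_mul_apply, ← sympForm]
  rcases a with i | i <;> rcases b with j | j <;> simp only [Sum.elim_inl, Sum.elim_inr]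
  · simp [sympForm_eq_sesqForm hH hsp, hσv, Jmat]
  · simp [-neg_smul, hinl, Jmat, one_apply]
  · simp [-neg_smul, sympForm_swap _ (v j), hinl, Jmat, one_apply, eq_comm]
  · rw [hsmul, sympForm_swap, hsmul, sympForm_quatConj_left hH, hvσ]
    simp [Jmat]

lemma IsQuatOrthonormal.conjTranspose_mul_mul (hH : H.IsHermitian) (hsp : IsSymplectic H)
    {v : Fin n → Fin n ⊕ Fin n → ℂ} {ε : Fin n → ℂ} (h : IsQuatOrthonormal H v ε) :
    (quatBasisMatrix H v ε)ᴴ * H * quatBasisMatrix H v ε =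
      fromBlocks (diagonal ε) 0 0 (diagonal ε) := by
  obtain ⟨hε, hv, hvσ⟩ := h
  have hσv : ∀ i j, sesqForm H (quatConj H (v i)) (v j) = 0 := fun i j => by
    rw [← star_sesqForm hH, hvσ, star_zero]
  ext a b
  rw [quatBasisMatrix, conjTranspose_mul_mul_apply]
  rcases a with i | i <;> rcases b with j | j
  · simp [hv, diagonal_apply]
  · simp [-neg_smul, hvσ, sesqForm_smul_right]
  · simp [-neg_smul, hσv, sesqForm_smul_left]
  · by_cases hij : i = j
    · subst hij
      rcases hε i with h | h <;>
        simp [-neg_smul, sesqForm_smul_left, sesqForm_smul_right, sesqForm_quatConj_quatConj hH hsp, hv, h]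
    · simp [-neg_smul, sesqForm_smul_left, sesqForm_smul_right, sesqForm_quatConj_quatConj hH hsp, hv, hij,
        Ne.symm hij]

end Quaternionic

/-- Any predicate on `Fin n` can be rearranged to hold exactly on an initial segment. -/
lemma exists_perm_iff_lt {n : ℕ} (P : Fin n → Prop) :
    ∃ p ≤ n, ∃ e : Equiv.Perm (Fin n), ∀ i, P (e i) ↔ (i : ℕ) < p := by
  classical
  have hle : Fintype.card {i // P i} ≤ n := by simpa using Fintype.card_subtype_le P
  let f : {i : Fin n // (i : ℕ) < Fintype.card {i // P i}} ≃ {i // P i} :=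
    Fintype.equivOfCardEq (by
      rw [Fintype.card_subtype, Fin.card_filter_val_lt, min_eq_right hle])
  refine ⟨_, hle, f.extendSubtype, fun i => ⟨fun h => ?_, fun h => f.extendSubtype_mem i h⟩⟩
  by_contra hi
  exact f.extendSubtype_not_mem i hi h

theorem stmt2 {n : ℕ} (hn : 0 < n)
    (H : Matrix (Fin n ⊕ Fin n) (Fin n ⊕ Fin n) ℂ)
    (hherm : H.IsHermitian) (hsp : IsSymplectic H) :
    ∃ p q : ℕ, p + q = n ∧
      ∃ S : Matrix (Fin n ⊕ Fin n) (Fin n ⊕ Fin n) ℂ,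
        IsSymplectic S ∧ Sᴴ * H * S = Kpq n p := by
  obtain ⟨v, ε, hv⟩ := exists_isQuatOrthonormal hherm hsp n le_rfl
  obtain ⟨p, hp, e, he⟩ := exists_perm_iff_lt fun i => ε i = 1
  have hv' := hv.comp_equiv e
  have hε : diagonal (ε ∘ e) = Ipq n p := by
    rw [Ipq]
    congr 1
    funext i
    split_ifs with h
    · exact (he i).2 h
    · exact (hv.1 (e i)).resolve_left fun h' => h ((he i).1 h')
  refine ⟨p, n - p, by omega, quatBasisMatrix H (v ∘ e) (ε ∘ e),
    hv'.isSymplectic hherm hsp, ?_⟩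
  rw [hv'.conjTranspose_mul_mul hherm hsp, hε, Kpq]
end
end

section
/- Let Γ be a group, n a positive integer, and ρ : Γ → O(2n,ℂ) an irreducible representation. Suppose there exists P ∈ GL(2n,ℂ) such that P·ρ(γ)·P⁻¹ = conj(ρ(γ)) for all γ ∈ Γ. Then there exists Q ∈ O(2n,ℂ) such that either (i) for all γ ∈ Γ, (Q·ρ(γ)·Q⁻¹)·J_{2n} = J_{2n}·conj(Q·ρ(γ)·Q⁻¹) (the conjugated representation takes values in the quaternionic orthogonal group O(n,ℍ)), or (ii) there exist natural numbers p, q with p + q = 2n such that for all γ ∈ Γ the matrix D_{p,q}⁻¹·Q·ρ(γ)·Q⁻¹·D_{p,q} has real entries (the conjugated representation takes values in the copy 𝒪_{p,q} = D_{p,q}·O(p,q)·D_{p,q}⁻¹ of O(p,q)). -/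
open Matrix

noncomputable section

/-- `M ∈ O(2n,ℂ)`, i.e. `ᵀM M = I_{2n}`. -/
def IsOrthoC {n : ℕ} (M : Matrix (Fin n ⊕ Fin n) (Fin n ⊕ Fin n) ℂ) : Prop :=
  Mᵀ * M = 1

/-- The position of an index of `Fin n ⊕ Fin n` in `{0, …, 2n−1}`. -/
def sumIdx {n : ℕ} : Fin n ⊕ Fin n → ℕ :=
  Sum.elim (fun i => (i : ℕ)) (fun i => n + (i : ℕ))

/-- The matrix `D_{p,q} = diag(I_p, i·I_q)` of size `2n` (with `p + q = 2n`). -/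
def DpqS (n p : ℕ) : Matrix (Fin n ⊕ Fin n) (Fin n ⊕ Fin n) ℂ :=
  Matrix.diagonal (fun i => if sumIdx i < p then 1 else Complex.I)

/-- A representation `ρ : Γ → GL(n,ℂ)` is irreducible if the only invariant
subspaces of `ℂⁿ` are `{0}` and `ℂⁿ`. -/
def MatIrreducible {Γ : Type*} [Group Γ] {ι : Type*} [Fintype ι] [DecidableEq ι]
    (ρ : Γ →* Matrix.GeneralLinearGroup ι ℂ) : Prop :=
  ∀ W : Submodule ℂ (ι → ℂ),
    (∀ γ : Γ, ∀ x ∈ W, Matrix.mulVec (ρ γ : Matrix ι ι ℂ) x ∈ W) →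
      W = ⊥ ∨ W = ⊤

open Complex ComplexConjugate

local notation:max M "ᶜʲ" => Matrix.map M (starRingEnd ℂ)

section Conj

variable {l m n : Type*}

lemma map_conj_map_conj (M : Matrix m n ℂ) : Mᶜʲᶜʲ = M := by
  ext; simp

lemma map_conj_mul [Fintype m] (M : Matrix l m ℂ) (N : Matrix m n ℂ) : (M * N)ᶜʲ = Mᶜʲ * Nᶜʲ :=
  Matrix.map_mul

lemma map_conj_one [DecidableEq n] : (1 : Matrix n n ℂ)ᶜʲ = 1 :=
  Matrix.map_one _ (map_zero _) (map_one _)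

lemma map_conj_smul (c : ℂ) (M : Matrix m n ℂ) : (c • M)ᶜʲ = conj c • Mᶜʲ := by
  ext; simp

lemma map_conj_transpose (M : Matrix m n ℂ) : Mᵀᶜʲ = Mᶜʲᵀ := rfl

lemma map_conj_diagonal_ofReal [DecidableEq n] (d : n → ℝ) :
    (diagonal fun i => (d i : ℂ))ᶜʲ = diagonal fun i => (d i : ℂ) := by
  rw [Matrix.diagonal_map (map_zero _)]
  simp

end Conj

section Irreducible

variable {Γ ι : Type*} [Group Γ] [Fintype ι] [DecidableEq ι]

/-- Schur's lemma for matrix representations. -/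
lemma MatIrreducible.exists_eq_smul_one [Nonempty ι] {ρ : Γ →* Matrix.GeneralLinearGroup ι ℂ}
    (hρ : MatIrreducible ρ) (M : Matrix ι ι ℂ)
    (hM : ∀ γ, M * (ρ γ : Matrix ι ι ℂ) = (ρ γ : Matrix ι ι ℂ) * M) :
    ∃ c : ℂ, M = c • (1 : Matrix ι ι ℂ) := by
  obtain ⟨c, hc⟩ := Module.End.exists_eigenvalue (Matrix.toLin' M)
  refine ⟨c, ?_⟩
  have hmem : ∀ x, x ∈ Module.End.eigenspace (Matrix.toLin' M) c ↔ M *ᵥ x = c • x := fun x => by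
    rw [Module.End.mem_eigenspace_iff, Matrix.toLin'_apply]
  have htop : Module.End.eigenspace (Matrix.toLin' M) c = ⊤ := by
    refine (hρ _ fun γ x hx => ?_).resolve_left hc
    rw [hmem] at hx ⊢
    rw [Matrix.mulVec_mulVec, hM, ← Matrix.mulVec_mulVec, hx, Matrix.mulVec_smul]
  refine Matrix.ext_of_mulVec_single fun i => ?_
  rw [(hmem _).1 (htop ▸ Submodule.mem_top), Matrix.smul_mulVec, Matrix.one_mulVec]

/-- An irreducible complex orthogonal representation that is isomorphic to its conjugate admits an
orthogonal intertwiner `P` onto its conjugate such that `conj P * P = ± 1`. -/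
lemma MatIrreducible.exists_orthogonal_intertwiner [Nonempty ι]
    {ρ : Γ →* Matrix.GeneralLinearGroup ι ℂ} (hρ : MatIrreducible ρ)
    (ho : ∀ γ, (ρ γ : Matrix ι ι ℂ)ᵀ * (ρ γ : Matrix ι ι ℂ) = 1)
    (P : Matrix ι ι ℂ) (hP : IsUnit P)
    (hconj : ∀ γ, P * (ρ γ : Matrix ι ι ℂ) * P⁻¹ = (ρ γ : Matrix ι ι ℂ)ᶜʲ) :
    ∃ P : Matrix ι ι ℂ, Pᵀ * P = 1 ∧
      (∀ γ, P * (ρ γ : Matrix ι ι ℂ) = (ρ γ : Matrix ι ι ℂ)ᶜʲ * P) ∧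
      (Pᶜʲ * P = 1 ∨ Pᶜʲ * P = -1) := by
  have hdet : IsUnit P.det := (Matrix.isUnit_iff_isUnit_det P).1 hP
  have hint : ∀ γ, P * (ρ γ : Matrix ι ι ℂ) = (ρ γ : Matrix ι ι ℂ)ᶜʲ * P := fun γ => by
    rw [← hconj, Matrix.mul_assoc, Matrix.nonsing_inv_mul P hdet, Matrix.mul_one]
  have hintT : ∀ γ, Pᵀ * (ρ γ : Matrix ι ι ℂ)ᶜʲ = (ρ γ : Matrix ι ι ℂ) * Pᵀ := fun γ => by
    set R := (ρ γ : Matrix ι ι ℂ)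
    have h1 : Rᵀ * Pᵀ = Pᵀ * Rᶜʲᵀ := by
      rw [← Matrix.transpose_mul, hint, Matrix.transpose_mul]
    have h2 : Rᶜʲᵀ * Rᶜʲ = 1 := by
      rw [← map_conj_transpose, ← map_conj_mul, ho, map_conj_one]
    have h3 : R * Rᵀ = 1 := mul_eq_one_comm.1 (ho γ)
    calc Pᵀ * Rᶜʲ = (R * Rᵀ) * Pᵀ * Rᶜʲ := by rw [h3, Matrix.one_mul]
      _ = R * (Rᵀ * Pᵀ) * Rᶜʲ := by simp only [Matrix.mul_assoc]
      _ = R * Pᵀ * (Rᶜʲᵀ * Rᶜʲ) := by rw [h1]; simp only [Matrix.mul_assoc]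
      _ = R * Pᵀ := by rw [h2, Matrix.mul_one]
  obtain ⟨c, hc⟩ := hρ.exists_eq_smul_one (Pᵀ * P) fun γ => by
    rw [Matrix.mul_assoc, hint, ← Matrix.mul_assoc, hintT, Matrix.mul_assoc]
  have hc0 : c ≠ 0 := by
    rintro rfl
    have := congrArg Matrix.det hc
    rw [Matrix.det_mul, Matrix.det_transpose, zero_smul, Matrix.det_zero] at this
    exact hdet.ne_zero (mul_self_eq_zero.1 this)
  obtain ⟨d, hd⟩ := IsAlgClosed.exists_pow_nat_eq c⁻¹ (n := 2) two_pos
  have hT : (d • P)ᵀ * (d • P) = 1 := by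
    rw [Matrix.transpose_smul, Matrix.smul_mul, Matrix.mul_smul, hc, smul_smul, smul_smul,
      ← pow_two, hd, inv_mul_cancel₀ hc0, one_smul]
  have hS : ∀ γ, (d • P) * (ρ γ : Matrix ι ι ℂ) = (ρ γ : Matrix ι ι ℂ)ᶜʲ * (d • P) := fun γ => by
    rw [Matrix.smul_mul, hint, Matrix.mul_smul]
  generalize d • P = S at hT hS
  refine ⟨S, hT, hS, ?_⟩
  have hSc : ∀ γ, Sᶜʲ * (ρ γ : Matrix ι ι ℂ)ᶜʲ = (ρ γ : Matrix ι ι ℂ) * Sᶜʲ := fun γ => by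
    rw [← map_conj_mul, hS, map_conj_mul, map_conj_map_conj]
  obtain ⟨μ, hμ⟩ := hρ.exists_eq_smul_one (Sᶜʲ * S) fun γ => by
    rw [Matrix.mul_assoc, hS, ← Matrix.mul_assoc, hSc, Matrix.mul_assoc]
  have hS0 : S ≠ 0 := by
    rintro rfl
    simp at hT
  have hμ' : S * Sᶜʲ = conj μ • (1 : Matrix ι ι ℂ) := by
    have := congrArg (fun M : Matrix ι ι ℂ => Mᶜʲ) hμ
    simpa only [map_conj_mul, map_conj_map_conj, map_conj_smul, map_conj_one] using this
  have hreal : conj μ = μ := by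
    have h : conj μ • S = μ • S := by
      calc conj μ • S = S * Sᶜʲ * S := by rw [hμ', Matrix.smul_mul, Matrix.one_mul]
        _ = μ • S := by rw [Matrix.mul_assoc, hμ, Matrix.mul_smul, Matrix.mul_one]
    exact smul_left_injective ℂ hS0 h
  have hSc' : Sᶜʲ = μ • Sᵀ := by
    calc Sᶜʲ = Sᶜʲ * (S * Sᵀ) := by rw [mul_eq_one_comm.1 hT, Matrix.mul_one]
      _ = μ • Sᵀ := by rw [← Matrix.mul_assoc, hμ, Matrix.smul_mul, Matrix.one_mul]
  have hsq : μ * μ = 1 := by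
    have h : (μ * μ) • S = (1 : ℂ) • S := by
      rw [one_smul]
      conv_rhs => rw [← map_conj_map_conj S, hSc', map_conj_smul, map_conj_transpose, hSc', hreal,
        Matrix.transpose_smul, Matrix.transpose_transpose, smul_smul]
    exact smul_left_injective ℂ hS0 h
  rcases mul_self_eq_one_iff.1 hsq with rfl | rfl
  · exact Or.inl (by rw [hμ, one_smul])
  · exact Or.inr (by rw [hμ, neg_smul, one_smul])

end Irreducible

section Spectral

variable {𝕜 ι : Type*} [RCLike 𝕜] [Fintype ι] [DecidableEq ι]

lemma Matrix.IsHermitian.exists_mul_eq_mul_diagonal {A : Matrix ι ι 𝕜} (hA : A.IsHermitian) :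
    ∃ (U : Matrix ι ι 𝕜) (d : ι → ℝ), Uᴴ * U = 1 ∧
      A * U = U * diagonal fun i => (d i : 𝕜) := by
  refine ⟨hA.eigenvectorUnitary, hA.eigenvalues, ?_, ?_⟩
  · exact Unitary.coe_star_mul_self _
  · have h := hA.spectral_theorem
    rw [Unitary.conjStarAlgAut_apply] at h
    have h' := congrArg (fun M => M * (hA.eigenvectorUnitary : Matrix ι ι 𝕜)) h
    simp only [Matrix.mul_assoc, Unitary.coe_star_mul_self, Matrix.mul_one] at h'
    exact h'

end Spectral

section RealForm

variable {ι : Type*} [Fintype ι] [DecidableEq ι]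

/-- Hilbert's theorem 90 for `GL(ι, ℂ)` over `ℝ`. -/
lemma exists_isUnit_map_conj_eq_mul (P : Matrix ι ι ℂ) (hP : Pᶜʲ * P = 1) :
    ∃ A : Matrix ι ι ℂ, IsUnit A ∧ Aᶜʲ = P * A := by
  have hne : ∀ t : ℝ, (1 - t * I : ℂ) ≠ 0 := fun t h => by
    simpa using congrArg Complex.re h
  let u : ℝ → ℂ := fun t => -((1 + t * I) / (1 - t * I))
  have hu : Function.Injective u := fun s t h => by
    have h' := neg_injective h
    rw [div_eq_div_iff (hne s) (hne t)] at h'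
    have := congrArg Complex.im h'
    simp at this
    linarith
  obtain ⟨t, ht⟩ := ((Matrix.finite_spectrum Pᶜʲ).preimage hu.injOn).exists_notMem
  rw [Set.mem_preimage, spectrum.notMem_iff] at ht
  refine ⟨(1 + t * I : ℂ) • 1 + (1 - t * I : ℂ) • Pᶜʲ, ?_, ?_⟩
  · have h : (1 + t * I : ℂ) • 1 + (1 - t * I : ℂ) • Pᶜʲ
        = (-(1 - t * I : ℂ)) • (algebraMap ℂ (Matrix ι ι ℂ) (u t) - Pᶜʲ) := by
      rw [Algebra.algebraMap_eq_smul_one, smul_sub, smul_smul]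
      simp only [u, neg_mul_neg, mul_div_cancel₀ _ (hne t), neg_smul, sub_neg_eq_add]
    rw [h]
    exact ht.smul (Units.mk0 _ (neg_ne_zero.2 (hne t)))
  · have hP' : P * Pᶜʲ = 1 := mul_eq_one_comm.1 hP
    rw [Matrix.map_add _ (map_add _), map_conj_smul, map_conj_smul, map_conj_one, map_conj_map_conj,
      Matrix.mul_add, Matrix.mul_smul, Matrix.mul_smul, hP', Matrix.mul_one, add_comm]
    simp [sub_eq_add_neg]

/-- Sylvester's law of inertia, existence part, with the signs in a prescribed position. -/
lemma exists_transpose_mul_mul_eq_diagonal_sign (G : Matrix ι ι ℝ) (hG : G.IsSymm)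
    (hdet : IsUnit G) (s : ℕ → ι → Prop) [∀ p, DecidablePred (s p)]
    (hs : ∀ p ≤ Fintype.card ι, Fintype.card {i // s p i} = p) :
    ∃ p ≤ Fintype.card ι, ∃ B : Matrix ι ι ℝ,
      Bᵀ * G * B = diagonal fun i => if s p i then 1 else -1 := by
  obtain ⟨U, d, hU, hGU⟩ := Matrix.IsHermitian.exists_mul_eq_mul_diagonal (A := G)
    (by rwa [Matrix.IsHermitian, Matrix.conjTranspose_eq_transpose_of_trivial])
  rw [Matrix.conjTranspose_eq_transpose_of_trivial] at hU
  simp only [RCLike.ofReal_real_eq_id, id] at hGU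
  have hUGU : Uᵀ * G * U = diagonal d := by
    rw [Matrix.mul_assoc, hGU, ← Matrix.mul_assoc, hU, Matrix.one_mul]
  have hd : ∀ i, d i ≠ 0 := by
    have hUu : IsUnit U := IsUnit.of_mul_eq_one _ (mul_eq_one_comm.1 hU)
    have hUu' : IsUnit Uᵀ := IsUnit.of_mul_eq_one _ hU
    have h := (hUu'.mul hdet).mul hUu
    rw [hUGU, Matrix.isUnit_iff_isUnit_det, Matrix.det_diagonal, isUnit_iff_ne_zero,
      Finset.prod_ne_zero_iff] at h
    exact fun i => h i (Finset.mem_univ i)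
  have hp : Fintype.card {i // 0 < d i} ≤ Fintype.card ι := Fintype.card_subtype_le _
  refine ⟨_, hp, ?_⟩
  set p := Fintype.card {i // 0 < d i}
  let e : {i // s p i} ≃ {i // 0 < d i} := Fintype.equivOfCardEq (hs p hp)
  let σ := e.extendSubtype
  refine ⟨(U * diagonal fun i => (√|d i|)⁻¹).submatrix id σ, ?_⟩
  have h : (U * diagonal fun i => (√|d i|)⁻¹)ᵀ * G * (U * diagonal fun i => (√|d i|)⁻¹)
      = diagonal fun i => if 0 < d i then 1 else -1 := by
    rw [Matrix.transpose_mul, Matrix.diagonal_transpose]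
    calc _ = (diagonal fun i => (√|d i|)⁻¹) * (Uᵀ * G * U) * diagonal fun i => (√|d i|)⁻¹ := by
          simp only [Matrix.mul_assoc]
      _ = _ := by
          rw [hUGU, Matrix.diagonal_mul_diagonal, Matrix.diagonal_mul_diagonal]
          congr 1
          funext i
          have h2 : (√|d i|)⁻¹ * d i * (√|d i|)⁻¹ = d i / |d i| := by
            rw [mul_right_comm, ← mul_inv, Real.mul_self_sqrt (abs_nonneg _), inv_mul_eq_div]
          rw [h2]
          split_ifs with h0
          · rw [abs_of_pos h0, div_self (hd i)]
          · rw [abs_of_nonpos (not_lt.1 h0), div_neg, div_self (hd i)]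
  set V := U * diagonal fun i => (√|d i|)⁻¹
  have h3 : (V.submatrix id σ)ᵀ * G * V.submatrix id σ = (Vᵀ * G * V).submatrix σ σ := by
    rw [Matrix.transpose_submatrix, ← Matrix.submatrix_mul_equiv _ _ _ (Equiv.refl ι) _,
      ← Matrix.submatrix_mul_equiv _ _ _ (Equiv.refl ι) _]
    rfl
  rw [h3, h, Matrix.submatrix_diagonal_equiv]
  congr 1
  funext i
  by_cases hi : s p i
  · simp [hi, e.extendSubtype_mem i hi, σ]
  · simp [hi, e.extendSubtype_not_mem i hi, σ]

lemma exists_transpose_mul_eq_diagonal_sign_of_conj_mul_eq_one (P : Matrix ι ι ℂ)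
    (hT : Pᵀ * P = 1) (hP : Pᶜʲ * P = 1) (s : ℕ → ι → Prop) [∀ p, DecidablePred (s p)]
    (hs : ∀ p ≤ Fintype.card ι, Fintype.card {i // s p i} = p) :
    ∃ p ≤ Fintype.card ι, ∃ E : Matrix ι ι ℂ, Eᶜʲ = P * E ∧
      Eᵀ * E = diagonal fun i => if s p i then 1 else -1 := by
  obtain ⟨A, hAu, hA⟩ := exists_isUnit_map_conj_eq_mul P hP
  have hAA : (Aᵀ * A)ᶜʲ = Aᵀ * A := by
    rw [map_conj_mul, map_conj_transpose, hA, Matrix.transpose_mul, Matrix.mul_assoc,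
      ← Matrix.mul_assoc Pᵀ, hT, Matrix.one_mul]
  let G : Matrix ι ι ℝ := (Aᵀ * A).map Complex.re
  have hG : G.map Complex.ofRealHom = Aᵀ * A := by
    ext i j
    exact Complex.conj_eq_iff_re.1 (congrFun (congrFun hAA i) j)
  have hGsymm : G.IsSymm :=
    Matrix.IsSymm.map (by rw [Matrix.IsSymm, Matrix.transpose_mul, Matrix.transpose_transpose]) _
  have hGu : IsUnit G := by
    have h : IsUnit (G.map Complex.ofRealHom) := by
      rw [hG]
      exact ((Matrix.isUnit_transpose A).2 hAu).mul hAu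
    rw [Matrix.isUnit_iff_isUnit_det, isUnit_iff_ne_zero] at h ⊢
    rintro h0
    apply h
    rw [← RingHom.mapMatrix_apply, ← RingHom.map_det, h0, map_zero]
  obtain ⟨p, hp, B, hB⟩ := exists_transpose_mul_mul_eq_diagonal_sign G hGsymm hGu s hs
  refine ⟨p, hp, A * B.map Complex.ofRealHom, ?_, ?_⟩
  · have hBc : (B.map Complex.ofRealHom)ᶜʲ = B.map Complex.ofRealHom := by
      ext; simp
    rw [map_conj_mul, hA, hBc, Matrix.mul_assoc]
  · have h := congrArg (fun M : Matrix ι ι ℝ => M.map Complex.ofRealHom) hB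
    simp only [Matrix.map_mul, hG, Matrix.transpose_map] at h
    rw [Matrix.diagonal_map (map_zero _)] at h
    rw [Matrix.transpose_mul]
    simp only [Matrix.mul_assoc] at h ⊢
    rw [h]
    congr 1
    funext i
    split_ifs <;> simp

end RealForm

section QuaternionicForm

variable {ι m : Type*} [Fintype ι] [DecidableEq ι] [Fintype m] [DecidableEq m]

lemma transpose_mul_eq_neg_of_conj_mul_eq_neg_one {P : Matrix ι ι ℂ} (hT : Pᵀ * P = 1)
    (hP : Pᶜʲ * P = -1) : Pᵀ = -Pᶜʲ := by
  calc Pᵀ = -(Pᶜʲ * P) * Pᵀ := by rw [hP, neg_neg, Matrix.one_mul]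
    _ = -Pᶜʲ := by
      rw [Matrix.neg_mul, Matrix.mul_assoc, mul_eq_one_comm.1 hT, Matrix.mul_one]

/-- If `P X = -i X diag(d)`, then `conj P X = -i X diag(d⁻¹)`. -/
lemma conj_mul_eq_of_mul_eq {P : Matrix ι ι ℂ} (hP : Pᶜʲ * P = -1) {X : Matrix ι m ℂ} {d : m → ℝ}
    (hd : ∀ i, d i ≠ 0) (hX : P * X = (-I) • (X * diagonal fun i => (d i : ℂ))) :
    Pᶜʲ * X = (-I) • (X * diagonal fun i => ((d i)⁻¹ : ℂ)) := by
  have h : (-I) • (Pᶜʲ * X * diagonal fun i => (d i : ℂ)) = -X := by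
    rw [Matrix.mul_assoc, ← Matrix.mul_smul, ← hX, ← Matrix.mul_assoc, hP, Matrix.neg_mul,
      Matrix.one_mul]
  have hdd : (diagonal fun i => (d i : ℂ)) * (diagonal fun i => ((d i)⁻¹ : ℂ)) = 1 := by
    rw [Matrix.diagonal_mul_diagonal, ← Matrix.diagonal_one]
    congr 1
    funext i
    exact mul_inv_cancel₀ (by exact_mod_cast hd i)
  calc Pᶜʲ * X = I • (((-I) • (Pᶜʲ * X * diagonal fun i => (d i : ℂ))) *
        diagonal fun i => ((d i)⁻¹ : ℂ)) := by
        rw [Matrix.smul_mul, smul_smul, Matrix.mul_assoc, hdd, Matrix.mul_one]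
        simp
    _ = _ := by rw [h, Matrix.neg_mul, smul_neg, neg_smul]

/-- Eigenvectors whose eigenvalues have the same sign span an isotropic subspace. -/
lemma transpose_mul_self_eq_zero_of_mul_eq {P : Matrix ι ι ℂ} (hT : Pᵀ * P = 1)
    (hP : Pᶜʲ * P = -1) {X : Matrix ι m ℂ} {d : m → ℝ} (hd : ∀ i j, 0 < d i * d j)
    (hX : P * X = (-I) • (X * diagonal fun i => (d i : ℂ))) : Xᵀ * X = 0 := by
  have hd0 : ∀ i, d i ≠ 0 := fun i h => by simpa [h] using hd i i
  have h1 : Xᵀ * P = I • ((diagonal fun i => ((d i)⁻¹ : ℂ)) * Xᵀ) := by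
    have h := congrArg Matrix.transpose (conj_mul_eq_of_mul_eq hP hd0 hX)
    rw [← neg_neg Pᶜʲ, ← transpose_mul_eq_neg_of_conj_mul_eq_neg_one hT hP, Matrix.neg_mul,
      Matrix.transpose_neg, Matrix.transpose_mul, Matrix.transpose_transpose,
      Matrix.transpose_smul, Matrix.transpose_mul, Matrix.diagonal_transpose, neg_smul] at h
    exact neg_injective h
  have h2 : I • ((diagonal fun i => ((d i)⁻¹ : ℂ)) * (Xᵀ * X))
      = (-I) • (Xᵀ * X * diagonal fun i => (d i : ℂ)) := by
    rw [← Matrix.mul_assoc, ← Matrix.smul_mul, ← h1, Matrix.mul_assoc, hX, Matrix.mul_smul,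
      Matrix.mul_assoc]
  ext i j
  have h3 := congrFun (congrFun h2 i) j
  simp only [Matrix.smul_apply, Matrix.diagonal_mul, Matrix.mul_diagonal, smul_eq_mul] at h3
  generalize (Xᵀ * X) i j = z at h3
  have hi : (d i : ℂ) ≠ 0 := by exact_mod_cast hd0 i
  have h4 : ((1 + d i * d j : ℝ) : ℂ) * z = 0 := by
    have h5 := congrArg (fun w => -I * d i * w) h3
    field_simp at h5
    push_cast
    linear_combination -h5
  have h6 : (1 + d i * d j : ℝ) ≠ 0 := by linarith [hd i j]
  exact (mul_eq_zero.1 h4).resolve_left (by exact_mod_cast h6)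

omit [DecidableEq ι] in
lemma two_mul_card_le_of_isotropic {X : Matrix ι m ℂ} (hU : Xᴴ * X = 1) (hX : Xᵀ * X = 0) :
    2 * Fintype.card m ≤ Fintype.card ι := by
  have h : (fromCols X Xᶜʲ)ᴴ * fromCols X Xᶜʲ = 1 := by
    have h1 : Xᴴ * Xᶜʲ = 0 := by
      have := congrArg (fun M : Matrix m m ℂ => Mᶜʲ) hX
      simp only [map_conj_mul] at this
      rw [← Matrix.map_zero _ (map_zero (starRingEnd ℂ)), ← this]
      rfl
    have h2 : Xᶜʲᴴ = Xᵀ := by ext; simp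
    have h3 : Xᵀ * Xᶜʲ = 1 := by
      have := congrArg (fun M : Matrix m m ℂ => Mᶜʲ) hU
      simp only [map_conj_mul, map_conj_one] at this
      rw [← this]
      congr 1
      ext; simp
    rw [Matrix.conjTranspose_fromCols_eq_fromRows_conjTranspose, Matrix.fromRows_mul_fromCols, hU,
      h1, h2, hX, h3, Matrix.fromBlocks_one]
  have h1 := Matrix.rank_mul_le_right (fromCols X Xᶜʲ)ᴴ (fromCols X Xᶜʲ)
  rw [h, Matrix.rank_one, Fintype.card_sum] at h1
  have h2 := Matrix.rank_le_card_height (fromCols X Xᶜʲ)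
  omega

end QuaternionicForm

/-- Half of the eigenvalues of `i P` are positive. -/
lemma exists_isotropic_eigenvectors {n : ℕ} {P : Matrix (Fin n ⊕ Fin n) (Fin n ⊕ Fin n) ℂ}
    (hT : Pᵀ * P = 1) (hP : Pᶜʲ * P = -1) :
    ∃ (X : Matrix (Fin n ⊕ Fin n) (Fin n) ℂ) (d : Fin n → ℝ), (∀ i, 0 < d i) ∧ Xᴴ * X = 1 ∧
      Xᵀ * X = 0 ∧ P * X = (-I) • (X * diagonal fun i => (d i : ℂ)) := by
  have hK : (I • P).IsHermitian := by
    have h : Pᴴ = -P := by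
      calc Pᴴ = Pᵀᶜʲ := rfl
        _ = -P := by
          rw [transpose_mul_eq_neg_of_conj_mul_eq_neg_one hT hP]
          ext; simp
    rw [Matrix.IsHermitian, Matrix.conjTranspose_smul, h]
    simp
  obtain ⟨U, d, hU, hd⟩ := hK.exists_mul_eq_mul_diagonal
  have hPU : P * U = (-I) • (U * diagonal fun i => (d i : ℂ)) := by
    rw [Matrix.smul_mul] at hd
    have h := congrArg (fun M => (-I) • M) hd
    simpa [smul_smul] using h
  have hd0 : ∀ i, d i ≠ 0 := by
    have hPu : IsUnit P := IsUnit.of_mul_eq_one _ (mul_eq_one_comm.1 hT)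
    have hUu : IsUnit U := IsUnit.of_mul_eq_one _ (mul_eq_one_comm.1 hU)
    have h := (hPu.smul (Units.mk0 I I_ne_zero)).mul hUu
    rw [Units.smul_mk0, hd, Matrix.isUnit_iff_isUnit_det, Matrix.det_mul, Matrix.det_diagonal] at h
    intro i hi
    apply (isUnit_of_mul_isUnit_right h).ne_zero
    exact Finset.prod_eq_zero (Finset.mem_univ i) (by simp [hi])
  have hsubP : ∀ {m : Type} [Fintype m] [DecidableEq m] (f : m → Fin n ⊕ Fin n),
      P * U.submatrix id f = (-I) • (U.submatrix id f * diagonal fun i => (d (f i) : ℂ)) := by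
    intro m _ _ f
    ext i j
    have := congrFun (congrFun hPU i) (f j)
    simpa [Matrix.mul_apply, Matrix.diagonal_apply] using this
  have hsubU : ∀ {m : Type} [Fintype m] [DecidableEq m] (f : m → Fin n ⊕ Fin n),
      Function.Injective f → (U.submatrix id f)ᴴ * U.submatrix id f = 1 := by
    intro m _ _ f hf
    ext i j
    have := congrFun (congrFun hU (f i)) (f j)
    simpa [Matrix.mul_apply, Matrix.one_apply, hf.eq_iff] using this
  have hpos : 2 * Fintype.card {i // 0 < d i} ≤ Fintype.card (Fin n ⊕ Fin n) :=
    two_mul_card_le_of_isotropic (hsubU _ Subtype.val_injective)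
      (transpose_mul_self_eq_zero_of_mul_eq hT hP (fun i j => mul_pos i.2 j.2) (hsubP _))
  have hneg : 2 * Fintype.card {i // ¬ 0 < d i} ≤ Fintype.card (Fin n ⊕ Fin n) :=
    two_mul_card_le_of_isotropic (hsubU _ Subtype.val_injective)
      (transpose_mul_self_eq_zero_of_mul_eq hT hP
        (fun i j => mul_pos_of_neg_of_neg (lt_of_le_of_ne (not_lt.1 i.2) (hd0 _))
          (lt_of_le_of_ne (not_lt.1 j.2) (hd0 _))) (hsubP _))
  have hcard : Fintype.card (Fin n) = Fintype.card {i // 0 < d i} := by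
    rw [Fintype.card_subtype_compl, Fintype.card_sum, Fintype.card_fin] at hneg
    rw [Fintype.card_sum, Fintype.card_fin] at hpos
    rw [Fintype.card_fin]
    omega
  let e := Fintype.equivOfCardEq hcard
  have he : Function.Injective fun i => (e i : Fin n ⊕ Fin n) :=
    Subtype.val_injective.comp e.injective
  exact ⟨U.submatrix id fun i => e i, fun i => d (e i), fun i => (e i).2, hsubU _ he,
    transpose_mul_self_eq_zero_of_mul_eq hT hP (fun i j => mul_pos (e i).2 (e j).2) (hsubP _),
    hsubP _⟩

lemma exists_orthogonal_mul_eq_conj_mul_Jmat {n : ℕ}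
    {P : Matrix (Fin n ⊕ Fin n) (Fin n ⊕ Fin n) ℂ} (hT : Pᵀ * P = 1) (hP : Pᶜʲ * P = -1) :
    ∃ W : Matrix (Fin n ⊕ Fin n) (Fin n ⊕ Fin n) ℂ, Wᵀ * W = 1 ∧ P * W = Wᶜʲ * Jmat n := by
  obtain ⟨X, d, hd, hU, hX, hPX⟩ := exists_isotropic_eigenvectors hT hP
  have hPXc : P * Xᶜʲ = I • (Xᶜʲ * diagonal fun i => ((d i)⁻¹ : ℂ)) := by
    have h := congrArg (fun M : Matrix (Fin n ⊕ Fin n) (Fin n) ℂ => Mᶜʲ)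
      (conj_mul_eq_of_mul_eq hP (fun i => (hd i).ne') hPX)
    have h' := map_conj_diagonal_ofReal fun i => (d i)⁻¹
    push_cast at h'
    simpa only [map_conj_mul, map_conj_smul, map_conj_map_conj, h', map_neg, conj_I, neg_neg]
      using h
  have hXcXc : Xᶜʲᵀ * Xᶜʲ = 0 := by
    rw [← map_conj_transpose, ← map_conj_mul, hX]
    ext; simp
  have hXcX : Xᶜʲᵀ * X = 1 := hU
  have hXXc : Xᵀ * Xᶜʲ = 1 := by
    rw [← Matrix.transpose_transpose Xᶜʲ, ← Matrix.transpose_mul, hXcX, Matrix.transpose_one]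
  let a : Fin n → ℝ := fun i => (√(2 * d i))⁻¹
  let b : Fin n → ℝ := fun i => d i * a i
  have hab : ∀ i, 2 * (a i * b i) = 1 := fun i => by
    have h : a i * a i = (2 * d i)⁻¹ := by
      rw [← mul_inv, Real.mul_self_sqrt (by linarith [hd i])]
    calc 2 * (a i * b i) = 2 * d i * (a i * a i) := by ring
      _ = 1 := by rw [h, mul_inv_cancel₀ (by linarith [hd i])]
  let α : Matrix (Fin n) (Fin n) ℂ := diagonal fun i => (a i : ℂ)
  let β : Matrix (Fin n) (Fin n) ℂ := diagonal fun i => (b i : ℂ)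
  have hαc : αᶜʲ = α := map_conj_diagonal_ofReal a
  have hβc : βᶜʲ = β := map_conj_diagonal_ofReal b
  have hαt : αᵀ = α := Matrix.diagonal_transpose _
  have hβt : βᵀ = β := Matrix.diagonal_transpose _
  have hβα : β * α = α * β := by
    simp only [α, β, Matrix.diagonal_mul_diagonal, mul_comm]
  have hαβ : α * β + α * β = 1 := by
    simp only [α, β, Matrix.diagonal_mul_diagonal, Matrix.diagonal_add, ← Matrix.diagonal_one]
    congr 1
    funext i
    rw [← two_mul]
    exact_mod_cast hab i
  have hdα : (diagonal fun i => (d i : ℂ)) * α = β := by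
    simp [α, β, b, Matrix.diagonal_mul_diagonal]
  have hdβ : (diagonal fun i => ((d i)⁻¹ : ℂ)) * β = α := by
    simp only [α, β, b, Matrix.diagonal_mul_diagonal]
    congr 1
    funext i
    have : (d i : ℂ) ≠ 0 := by exact_mod_cast (hd i).ne'
    push_cast
    field_simp
  have hPXα : P * (X * α) = (-I) • (X * β) := by
    rw [← Matrix.mul_assoc, hPX, Matrix.smul_mul, Matrix.mul_assoc, hdα]
  have hPXβ : P * (Xᶜʲ * β) = I • (Xᶜʲ * α) := by
    rw [← Matrix.mul_assoc, hPXc, Matrix.smul_mul, Matrix.mul_assoc, hdβ]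
  have hmul : ∀ (Y Z : Matrix (Fin n ⊕ Fin n) (Fin n) ℂ) (s t : Matrix (Fin n) (Fin n) ℂ),
      (Y * s)ᵀ * (Z * t) = sᵀ * (Yᵀ * Z) * t := fun Y Z s t => by
    rw [Matrix.transpose_mul]
    simp only [Matrix.mul_assoc]
  refine ⟨fromCols (X * α + Xᶜʲ * β) (I • (X * α - Xᶜʲ * β)), ?_, ?_⟩
  · rw [Matrix.transpose_fromCols, Matrix.fromRows_mul_fromCols, ← Matrix.fromBlocks_one]
    simp only [Matrix.transpose_add, Matrix.transpose_smul, Matrix.transpose_sub, Matrix.add_mul,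
      Matrix.mul_add, Matrix.sub_mul, Matrix.mul_sub, Matrix.smul_mul, Matrix.mul_smul, hmul, hX,
      hXcX, hXXc, hXcXc, hαt, hβt, Matrix.mul_zero, Matrix.zero_mul, Matrix.mul_one, hβα]
    congr 1
    · simpa using hαβ
    · simp
    · simp
    · simp only [smul_sub, smul_smul, I_mul_I, zero_sub, sub_zero, smul_neg, neg_smul, one_smul,
        neg_neg, sub_neg_eq_add]
      exact hαβ
  · have hc : (fromCols (X * α + Xᶜʲ * β) (I • (X * α - Xᶜʲ * β)))ᶜʲ
        = fromCols (Xᶜʲ * α + X * β) ((-I) • (Xᶜʲ * α - X * β)) := by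
      have h1 : (X * α + Xᶜʲ * β)ᶜʲ = Xᶜʲ * α + X * β := by
        rw [Matrix.map_add _ (map_add _), map_conj_mul, map_conj_mul, hαc, hβc, map_conj_map_conj]
      have h2 : (I • (X * α - Xᶜʲ * β))ᶜʲ = (-I) • (Xᶜʲ * α - X * β) := by
        rw [map_conj_smul, Matrix.map_sub _ (map_sub _), map_conj_mul, map_conj_mul, hαc, hβc,
          map_conj_map_conj, conj_I]
      rw [← h1, ← h2]
      ext i (j | j) <;> rfl
    rw [hc, Jmat, Matrix.mul_fromCols, Matrix.fromCols_mul_fromBlocks, Matrix.mul_add,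
      Matrix.mul_smul, Matrix.mul_sub, hPXα, hPXβ]
    simp only [Matrix.mul_zero, Matrix.mul_one, zero_add, add_zero, Matrix.mul_neg]
    congr 1
    · module
    · rw [smul_sub, smul_smul, smul_smul]
      simp [add_comm]

lemma card_sumIdx_lt {n p : ℕ} (hp : p ≤ Fintype.card (Fin n ⊕ Fin n)) :
    Fintype.card {i : Fin n ⊕ Fin n // sumIdx i < p} = p := by
  rw [Fintype.card_sum, Fintype.card_fin] at hp
  have e : {i : Fin n ⊕ Fin n // sumIdx i < p} ≃ {j : Fin (n + n) // (j : ℕ) < p} :=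
    finSumFinEquiv.subtypeEquiv fun i => by
      rcases i with i | i <;> simp [sumIdx, add_comm]
  rw [Fintype.card_congr e, Fintype.card_subtype]
  rw [Fin.card_filter_val_lt, min_eq_right hp]

theorem stmt11 {Γ : Type*} [Group Γ] {n : ℕ} (hn : 0 < n)
    (ρ : Γ →* Matrix.GeneralLinearGroup (Fin n ⊕ Fin n) ℂ)
    (ho : ∀ γ : Γ, IsOrthoC (ρ γ : Matrix (Fin n ⊕ Fin n) (Fin n ⊕ Fin n) ℂ))
    (hirr : MatIrreducible ρ)
    (P : Matrix (Fin n ⊕ Fin n) (Fin n ⊕ Fin n) ℂ) (hP : IsUnit P)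
    (hconj : ∀ γ : Γ, P * (ρ γ : Matrix (Fin n ⊕ Fin n) (Fin n ⊕ Fin n) ℂ) * P⁻¹
        = (ρ γ : Matrix (Fin n ⊕ Fin n) (Fin n ⊕ Fin n) ℂ).map (starRingEnd ℂ)) :
    ∃ Q : Matrix (Fin n ⊕ Fin n) (Fin n ⊕ Fin n) ℂ, IsOrthoC Q ∧
      ((∀ γ : Γ,
          (Q * (ρ γ : Matrix (Fin n ⊕ Fin n) (Fin n ⊕ Fin n) ℂ) * Q⁻¹) * Jmat n
            = Jmat n *
              (Q * (ρ γ : Matrix (Fin n ⊕ Fin n) (Fin n ⊕ Fin n) ℂ) * Q⁻¹).map (starRingEnd ℂ)) ∨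
       (∃ p q : ℕ, p + q = 2 * n ∧ ∀ γ : Γ,
          ((DpqS n p)⁻¹ * Q * (ρ γ : Matrix (Fin n ⊕ Fin n) (Fin n ⊕ Fin n) ℂ) * Q⁻¹ *
              DpqS n p).map (starRingEnd ℂ)
            = (DpqS n p)⁻¹ * Q * (ρ γ : Matrix (Fin n ⊕ Fin n) (Fin n ⊕ Fin n) ℂ) * Q⁻¹ *
              DpqS n p)) := by
  have : Nonempty (Fin n ⊕ Fin n) := ⟨Sum.inl ⟨0, hn⟩⟩
  obtain ⟨S, hT, hS, hS1 | hS1⟩ := hirr.exists_orthogonal_intertwiner ho P hP hconj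
  · obtain ⟨p, hp, E, hE, hEE⟩ := exists_transpose_mul_eq_diagonal_sign_of_conj_mul_eq_one S hT hS1
      (fun p (i : Fin n ⊕ Fin n) => sumIdx i < p) fun p hp => card_sumIdx_lt hp
    set D : Matrix (Fin n ⊕ Fin n) (Fin n ⊕ Fin n) ℂ := DpqS n p with hD
    let D' : Matrix (Fin n ⊕ Fin n) (Fin n ⊕ Fin n) ℂ :=
      diagonal fun i => if sumIdx i < p then 1 else -I
    have hD'D : D' * D = 1 := by
      simp only [hD, D', DpqS, Matrix.diagonal_mul_diagonal, ← Matrix.diagonal_one]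
      congr 1
      funext i
      split_ifs <;> simp
    have hW : (E * D')ᵀ * (E * D') = 1 := by
      rw [Matrix.transpose_mul, Matrix.mul_assoc, ← Matrix.mul_assoc Eᵀ, hEE]
      simp only [D', Matrix.diagonal_transpose, Matrix.diagonal_mul_diagonal,
        ← Matrix.diagonal_one]
      congr 1
      funext i
      split_ifs <;> simp
    have hWD : E * D' * D = E := by rw [Matrix.mul_assoc, hD'D, Matrix.mul_one]
    set W := E * D'
    refine ⟨Wᵀ, ?_, Or.inr ⟨p, 2 * n - p, ?_, fun γ => ?_⟩⟩
    · rw [IsOrthoC, Matrix.transpose_transpose, mul_eq_one_comm.1 hW]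
    · rw [Fintype.card_sum, Fintype.card_fin] at hp
      omega
    · rw [Matrix.inv_eq_right_inv hW, Matrix.inv_eq_left_inv hD'D, Matrix.mul_assoc _ W, hWD]
      have hFE : D' * Wᵀ * E = 1 := by
        rw [← hWD, Matrix.mul_assoc, ← Matrix.mul_assoc Wᵀ, hW, Matrix.one_mul, hD'D]
      generalize D' * Wᵀ = F at hFE
      have hFS : Fᶜʲ * S = F := by
        have h := congrArg (fun M : Matrix (Fin n ⊕ Fin n) (Fin n ⊕ Fin n) ℂ => Mᶜʲ) hFE
        simp only [map_conj_mul, map_conj_one, hE, ← Matrix.mul_assoc] at h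
        calc Fᶜʲ * S = Fᶜʲ * S * (E * F) := by rw [mul_eq_one_comm.1 hFE, Matrix.mul_one]
          _ = F := by rw [← Matrix.mul_assoc, h, Matrix.one_mul]
      rw [map_conj_mul, map_conj_mul, hE, Matrix.mul_assoc, ← Matrix.mul_assoc _ S, ← hS,
        ← Matrix.mul_assoc, ← Matrix.mul_assoc, hFS]
  · obtain ⟨W, hW, hSW⟩ := exists_orthogonal_mul_eq_conj_mul_Jmat hT hS1
    refine ⟨Wᵀ, ?_, Or.inl fun γ => ?_⟩
    · rw [IsOrthoC, Matrix.transpose_transpose, mul_eq_one_comm.1 hW]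
    · rw [Matrix.inv_eq_right_inv hW]
      have hWc : Wᶜʲᵀ * Wᶜʲ = 1 := by
        rw [← map_conj_transpose, ← map_conj_mul, hW, map_conj_one]
      have hJ : (Jmat n)ᶜʲ = Jmat n := by
        ext i j
        rcases i with i | i <;> rcases j with j | j <;>
          simp [Jmat, Matrix.one_apply, apply_ite (starRingEnd ℂ)]
      have hWS : Wᶜʲᵀ * S = Jmat n * Wᵀ := by
        calc Wᶜʲᵀ * S = Wᶜʲᵀ * (S * W) * Wᵀ := by
              rw [← Matrix.mul_assoc, Matrix.mul_assoc, mul_eq_one_comm.1 hW, Matrix.mul_one]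
          _ = Jmat n * Wᵀ := by rw [hSW, ← Matrix.mul_assoc, hWc, Matrix.one_mul]
      have h : (Wᵀ * (ρ γ).1 * W)ᶜʲ * Jmat n = Jmat n * (Wᵀ * (ρ γ).1 * W) := by
        calc (Wᵀ * (ρ γ).1 * W)ᶜʲ * Jmat n = Wᶜʲᵀ * (ρ γ).1ᶜʲ * (Wᶜʲ * Jmat n) := by
              rw [map_conj_mul, map_conj_mul, map_conj_transpose, Matrix.mul_assoc]
          _ = Wᶜʲᵀ * ((ρ γ).1ᶜʲ * S) * W := by
              rw [← hSW]
              simp only [Matrix.mul_assoc]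
          _ = Jmat n * (Wᵀ * (ρ γ).1 * W) := by
              rw [← hS, ← Matrix.mul_assoc, hWS]
              simp only [Matrix.mul_assoc]
      have h' := congrArg (fun M : Matrix (Fin n ⊕ Fin n) (Fin n ⊕ Fin n) ℂ => Mᶜʲ) h
      rwa [map_conj_mul, map_conj_mul (Jmat n), map_conj_map_conj, hJ] at h'
end
end
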